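/- arXiv:2305.17161 — 4 statements merged into one kernel-verified Lean document; each statement's English description precedes it below -/
import Mathlib

section
/- For every ε > 0 there exist a probability measure p0 = q0 on ℝ and time-dependent vector fields u, v : [0,1] × ℝ → ℝ admitting flows φ, ψ (with φ_0 = ψ_0 = id, ∂_t φ_t(θ) = u_t(φ_t(θ)) for all t, and the right-derivative ∂_t^+ ψ_t(θ) = v_t(ψ_t(θ)) for all t ∈ [0,1)) such that, with p_t = (φ_t)_* p0, p1 = (φ_1)_* p0 and q1 = (ψ_1)_* q0: MSE_p(u,v) < ε, D_KL(p1 ‖ q1) = +∞, and the support of q1 is a proper subset of the support of p1. -/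
open MeasureTheory Real Set
open scoped ENNReal Classical

/-- Kullback–Leibler divergence: `∫ log(dp/dq) dp` if `p ≪ q` (and the log-likelihood ratio is
integrable), `+∞` otherwise. -/
noncomputable def klDiv {α : Type*} [MeasurableSpace α] (p q : Measure α) : ℝ≥0∞ :=
  if p ≪ q ∧ Integrable (llr p q) p then ENNReal.ofReal (∫ x, llr p q x ∂p) else ⊤

/-- The (topological) support of a measure: the set of points all of whose neighborhoods have
positive measure. -/
def msupport {α : Type*} [TopologicalSpace α] [MeasurableSpace α] (μ : Measure α) : Set α :=
  {x | ∀ U ∈ nhds x, μ U ≠ 0}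

/-- The uniform probability measure on `[-1, 1]`. -/
noncomputable def uniformBase : Measure ℝ := ProbabilityTheory.cond volume (Icc (-1) 1)

/-- The autonomous field equal to `δ` on `[0, δ)` and to `0` elsewhere. -/
noncomputable def trapField (δ θ : ℝ) : ℝ := if θ ∈ Ico 0 δ then δ else 0

/-- The flow of `trapField δ`, which pushes the points of `[0, δ)` to the right until they
stop at `δ`. -/
noncomputable def trapFlow (δ t θ : ℝ) : ℝ := if θ ∈ Ico 0 δ then min (θ + δ * t) δ else θ

instance isProbabilityMeasure_uniformBase : IsProbabilityMeasure uniformBase :=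
  ProbabilityTheory.cond_isProbabilityMeasure_of_finite (by simp) (by simp)

lemma uniformBase_eq_zero_iff (s : Set ℝ) :
    uniformBase s = 0 ↔ volume (Icc (-1) 1 ∩ s) = 0 := by
  simp [uniformBase, ProbabilityTheory.cond_apply measurableSet_Icc]

lemma msupport_uniformBase : msupport uniformBase = Icc (-1) 1 := by
  ext x
  refine ⟨fun hx => ?_, fun hx U hU h => ?_⟩
  · by_contra hx'
    refine hx _ (isClosed_Icc.isOpen_compl.mem_nhds hx') ?_
    rw [uniformBase_eq_zero_iff, inter_compl_self, measure_empty]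
  · obtain ⟨V, hVU, hV, hxV⟩ := mem_nhds_iff.1 hU
    have hx' : x ∈ closure (Ioo (-1 : ℝ) 1) := by
      rwa [closure_Ioo (by norm_num)]
    have hpos := (hV.inter isOpen_Ioo).measure_pos volume (mem_closure_iff.1 hx' V hV hxV)
    refine hpos.ne' (measure_mono_null ?_ ((uniformBase_eq_zero_iff U).1 h))
    exact fun y hy => ⟨Ioo_subset_Icc_self hy.2, hVU hy.1⟩

lemma trapFlow_zero (δ : ℝ) : trapFlow δ 0 = id := by
  ext θ
  unfold trapFlow
  split_ifs with h
  · simp [h.2.le]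
  · rfl

lemma trapFlow_one (δ θ : ℝ) : trapFlow δ 1 θ = if θ ∈ Ico 0 δ then δ else θ := by
  unfold trapFlow
  split_ifs with h
  · exact min_eq_right (by linarith [h.1])
  · rfl

lemma measurable_trapFlow (δ t : ℝ) : Measurable (trapFlow δ t) :=
  Measurable.ite measurableSet_Ico (by fun_prop) measurable_id

lemma hasDerivWithinAt_trapFlow {δ t : ℝ} (hδ : 0 < δ) (ht : 0 ≤ t) (θ : ℝ) :
    HasDerivWithinAt (fun s => trapFlow δ s θ) (trapField δ (trapFlow δ t θ)) (Ici t) t := by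
  by_cases hθ : θ ∈ Ico 0 δ
  · simp only [trapFlow, if_pos hθ]
    rcases lt_or_ge (θ + δ * t) δ with h | h
    · have hv : trapField δ (min (θ + δ * t) δ) = δ := by
        rw [min_eq_left h.le]
        exact if_pos ⟨add_nonneg hθ.1 (mul_nonneg hδ.le ht), h⟩
      have hlin : HasDerivAt (fun s => θ + δ * s) δ t := by
        simpa using ((hasDerivAt_id t).const_mul δ).const_add θ
      rw [hv]
      refine (hlin.congr_of_eventuallyEq ?_).hasDerivWithinAt
      filter_upwards [hlin.continuousAt.eventually_lt_const h] with s hs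
      exact min_eq_left hs.le
    · have hv : trapField δ (min (θ + δ * t) δ) = 0 := by
        simp [min_eq_right h, trapField]
      rw [hv]
      refine (hasDerivWithinAt_const t (Ici t) δ).congr (fun s hs => ?_) (min_eq_right h)
      exact min_eq_right (h.trans (by gcongr; exact hs))
  · simpa only [trapFlow, if_neg hθ, trapField] using hasDerivWithinAt_const t (Ici t) θ

lemma integral_sq_trapField_le (δ : ℝ) (μ : Measure ℝ) [IsProbabilityMeasure μ] :
    ‖∫ θ, |0 - trapField δ θ| ^ 2 ∂μ‖ ≤ δ ^ 2 := by
  have h : ∀ θ, ‖|0 - trapField δ θ| ^ 2‖ ≤ δ ^ 2 := by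
    intro θ
    unfold trapField
    split_ifs
    · simp
    · simpa using sq_nonneg δ
  simpa using norm_integral_le_of_norm_le_const (μ := μ) (.of_forall h)

lemma map_trapFlow_one_Ioo (δ : ℝ) (μ : Measure ℝ) :
    Measure.map (trapFlow δ 1) μ (Ioo 0 δ) = 0 := by
  rw [Measure.map_apply (measurable_trapFlow δ 1) measurableSet_Ioo]
  convert measure_empty (μ := μ)
  ext θ
  simp only [mem_preimage, trapFlow_one, mem_empty_iff_false, iff_false]
  split_ifs with h
  · simp
  · exact fun hθ => h (Ioo_subset_Ico_self hθ)

lemma msupport_map_trapFlow_one_subset {δ : ℝ} (hδ : 0 < δ) (hδ1 : δ ≤ 1) :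
    msupport (Measure.map (trapFlow δ 1) uniformBase) ⊆ Icc (-1) 1 := by
  intro x hx
  by_contra hx'
  refine hx _ (isClosed_Icc.isOpen_compl.mem_nhds hx') ?_
  rw [Measure.map_apply (measurable_trapFlow δ 1) measurableSet_Icc.compl,
    uniformBase_eq_zero_iff]
  convert measure_empty (μ := (volume : Measure ℝ))
  ext θ
  simp only [mem_inter_iff, mem_preimage, mem_compl_iff, trapFlow_one, mem_empty_iff_false,
    iff_false, not_and, not_not]
  intro hθ
  split_ifs
  · exact ⟨by linarith, hδ1⟩
  · exact hθ

lemma klDiv_eq_top_of_not_absolutelyContinuous {α : Type*} [MeasurableSpace α]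
    {p q : Measure α} (h : ¬ p ≪ q) : klDiv p q = ⊤ :=
  if_neg fun h' => h h'.1

/-- For every `ε > 0` there are a base distribution `p₀ = q₀` and vector fields `u`, `v` with
flows `φ`, `ψ` such that the mean squared error between `u` and `v` is below `ε`, while
`D_KL(p₁‖q₁) = ∞` and the support of `q₁ = (ψ₁)_*q₀` is a proper subset of the support of
`p₁ = (φ₁)_*p₀`. -/
theorem small_mse_infinite_kl (ε : ℝ) (hε : 0 < ε) :
    ∃ (p₀ : Measure ℝ) (u v φ ψ : ℝ → ℝ → ℝ),
      IsProbabilityMeasure p₀ ∧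
      φ 0 = id ∧ ψ 0 = id ∧
      (∀ t : ℝ, ∀ θ : ℝ, HasDerivAt (fun s => φ s θ) (u t (φ t θ)) t) ∧
      (∀ t ∈ Ico (0 : ℝ) 1, ∀ θ : ℝ,
        HasDerivWithinAt (fun s => ψ s θ) (v t (ψ t θ)) (Ici t) t) ∧
      (∫ t in (0 : ℝ)..1, ∫ θ, |u t θ - v t θ| ^ 2 ∂(Measure.map (φ t) p₀)) < ε ∧
      klDiv (Measure.map (φ 1) p₀) (Measure.map (ψ 1) p₀) = ⊤ ∧
      msupport (Measure.map (ψ 1) p₀) ⊂ msupport (Measure.map (φ 1) p₀) := by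
  obtain ⟨δ, hδ, hδ1, hδε⟩ : ∃ δ : ℝ, 0 < δ ∧ δ ≤ 1 ∧ δ ^ 2 < ε := by
    refine ⟨min (ε / 2) 1, by positivity, min_le_right _ _, ?_⟩
    have h0 : 0 < min (ε / 2) 1 := by positivity
    nlinarith [min_le_left (ε / 2) 1, min_le_right (ε / 2) 1]
  have hmid : δ / 2 ∈ Ioo 0 δ := ⟨by linarith, by linarith⟩
  have hmem : δ / 2 ∈ msupport uniformBase := by
    rw [msupport_uniformBase]
    exact ⟨by linarith, by linarith⟩
  have hnhds : Ioo 0 δ ∈ nhds (δ / 2) := isOpen_Ioo.mem_nhds hmid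
  have hnull := map_trapFlow_one_Ioo δ uniformBase
  have hid : Measure.map (fun θ : ℝ => θ) uniformBase = uniformBase := Measure.map_id
  refine ⟨uniformBase, fun _ _ => 0, fun _ => trapField δ, fun _ θ => θ, trapFlow δ,
    inferInstance, rfl, trapFlow_zero δ, fun t θ => hasDerivAt_const t θ,
    fun t ht θ => hasDerivWithinAt_trapFlow hδ ht.1 θ, ?_, ?_, ?_⟩
  · simp only [hid]
    refine (le_abs_self _).trans_lt (lt_of_le_of_lt ?_ hδε)
    simpa using integral_sq_trapField_le δ uniformBase
  · rw [hid]
    exact klDiv_eq_top_of_not_absolutelyContinuous fun h => hmem _ hnhds (h hnull)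
  · rw [hid]
    refine (ssubset_iff_of_subset ?_).2 ⟨δ / 2, hmem, fun h => h _ hnhds hnull⟩
    rw [msupport_uniformBase]
    exact msupport_map_trapFlow_one_subset hδ hδ1
end

section
/- Let N[μ, σ²](x) = (2πσ²)^{−1/2} exp(−(x − μ)²/(2σ²)) denote the Gaussian density on ℝ, and define g_{μ,σ²}(x) = x · N[μ, σ²](x). Then for all σ₁, σ₂ > 0 and μ₂, θ ∈ ℝ, the convolution satisfies (g_{0,σ₁²} ∗ N[μ₂, σ₂²])(θ) = ∫_ℝ (θ − y) · N[0, σ₁²](θ − y) · N[μ₂, σ₂²](y) dy = (σ₁²/(σ₁² + σ₂²)) · (θ − μ₂) · N[μ₂, σ₁² + σ₂²](θ). -/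
open MeasureTheory Real

/-- The one-dimensional Gaussian probability density with mean `μ` and variance `v`. -/
noncomputable def gaussDensity (μ v x : ℝ) : ℝ :=
  (Real.sqrt (2 * Real.pi * v))⁻¹ * Real.exp (-(x - μ) ^ 2 / (2 * v))

/-- `g_{μ,σ²}(x) = x · N[μ, σ²](x)`. -/
noncomputable def gFun (μ v x : ℝ) : ℝ := x * gaussDensity μ v x

open ProbabilityTheory

theorem gaussDensity_eq_gaussianPDFReal (μ : ℝ) (v : NNReal) (x : ℝ) :
    gaussDensity μ v x = gaussianPDFReal μ v x := rfl

/-- The integral of `x ↦ θ - x` against a Gaussian density of positive variance. -/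
theorem integral_sub_mul_gaussDensity (θ μ : ℝ) {v : ℝ} (hv : 0 < v) :
    ∫ x : ℝ, (θ - x) * gaussDensity μ v x = θ - μ := by
  lift v to NNReal using hv.le
  have hv0 : v ≠ 0 := by
    rintro rfl
    simp at hv
  have hint : Integrable (fun x : ℝ => x) (gaussianReal μ v) :=
    memLp_one_iff_integrable.1 (memLp_id_gaussianReal' 1 ENNReal.one_ne_top)
  calc ∫ x : ℝ, (θ - x) * gaussDensity μ v x
      = ∫ x, (θ - x) ∂(gaussianReal μ v) := by
        rw [integral_gaussianReal_eq_integral_smul hv0]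
        simp only [gaussDensity_eq_gaussianPDFReal, smul_eq_mul, mul_comm]
    _ = θ - μ := by
        rw [integral_sub (integrable_const θ) hint, integral_id_gaussianReal]
        simp

/-- Completing the square in a product of two Gaussian densities. -/
theorem gaussDensity_sub_mul_gaussDensity (μ θ y : ℝ) {a b : ℝ} (ha : 0 < a) (hb : 0 < b) :
    gaussDensity 0 a (θ - y) * gaussDensity μ b y
      = gaussDensity μ (a + b) θ
        * gaussDensity ((a * μ + b * θ) / (a + b)) (a * b / (a + b)) y := by
  have hab : 0 < a + b := add_pos ha hb
  unfold gaussDensity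
  rw [mul_mul_mul_comm, mul_mul_mul_comm (√(2 * π * (a + b)))⁻¹, ← mul_inv, ← mul_inv,
    ← Real.exp_add, ← Real.exp_add, ← Real.sqrt_mul (by positivity), ← Real.sqrt_mul (by positivity)]
  congr 2
  · congr 1
    field_simp
  · field_simp
    ring

/-- The convolution identity
`(g_{0,σ₁²} ∗ N[μ₂, σ₂²])(θ) = (σ₁²/(σ₁² + σ₂²)) · (θ − μ₂) · N[μ₂, σ₁² + σ₂²](θ)`. -/
theorem gauss_first_moment_convolution (σ₁ σ₂ μ₂ θ : ℝ) (hσ₁ : 0 < σ₁) (hσ₂ : 0 < σ₂) :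
    ∫ y : ℝ, gFun 0 (σ₁ ^ 2) (θ - y) * gaussDensity μ₂ (σ₂ ^ 2) y
      = σ₁ ^ 2 / (σ₁ ^ 2 + σ₂ ^ 2) * (θ - μ₂) * gaussDensity μ₂ (σ₁ ^ 2 + σ₂ ^ 2) θ := by
  have hσ₁' : 0 < σ₁ ^ 2 := by positivity
  have hσ₂' : 0 < σ₂ ^ 2 := by positivity
  have hprod (y : ℝ) : gFun 0 (σ₁ ^ 2) (θ - y) * gaussDensity μ₂ (σ₂ ^ 2) y
      = gaussDensity μ₂ (σ₁ ^ 2 + σ₂ ^ 2) θ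
        * ((θ - y) * gaussDensity ((σ₁ ^ 2 * μ₂ + σ₂ ^ 2 * θ) / (σ₁ ^ 2 + σ₂ ^ 2))
          (σ₁ ^ 2 * σ₂ ^ 2 / (σ₁ ^ 2 + σ₂ ^ 2)) y) := by
    rw [gFun, mul_assoc, gaussDensity_sub_mul_gaussDensity μ₂ θ y hσ₁' hσ₂', mul_left_comm]
  simp_rw [hprod]
  rw [integral_const_mul, integral_sub_mul_gaussDensity _ _ (by positivity), mul_comm]
  congr 1
  field_simp
  ring
end

section
/- Let σ_min ∈ (0, 1) and θ₁ ∈ ℝ. Define σ_t := 1 − (1 − σ_min)t and ψ_t(θ₀) := t·θ₁ + σ_t·θ₀ for t ∈ [0, 1], θ₀ ∈ ℝ. Then: (i) ψ_0 = id; (ii) for every t ∈ [0, 1] and θ₀ ∈ ℝ, (d/dt) ψ_t(θ₀) = (θ₁ − (1 − σ_min)·ψ_t(θ₀))/σ_t, i.e., ψ is the flow of the vector field u_t(θ) = (θ₁ − (1 − σ_min)θ)/(1 − (1 − σ_min)t); (iii) for every t ∈ [0, 1], the pushforward of the standard Gaussian measure N(0, 1) on ℝ under ψ_t is the Gaussian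 measure with mean t·θ₁ and variance σ_t². -/
open MeasureTheory ProbabilityTheory Real Set

/-- The affine flow `ψ_t(θ₀) = t·θ₁ + σ_t·θ₀` with `σ_t = 1 − (1 − σ_min)t` is the flow of the
optimal-transport sample-conditional vector field
`u_t(θ) = (θ₁ − (1 − σ_min)θ)/(1 − (1 − σ_min)t)`, and it transports the standard Gaussian
`N(0,1)` to the Gaussian conditional probability path `N(t·θ₁, σ_t²)`. -/
theorem ot_conditional_flow (σmin θ₁ : ℝ) (hσmin : σmin ∈ Set.Ioo (0 : ℝ) 1)
    (σ : ℝ → ℝ) (hσ : ∀ t, σ t = 1 - (1 - σmin) * t)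
    (ψ : ℝ → ℝ → ℝ) (hψ : ∀ t θ₀, ψ t θ₀ = t * θ₁ + σ t * θ₀) :
    ψ 0 = id ∧
    (∀ t ∈ Icc (0 : ℝ) 1, ∀ θ₀ : ℝ,
      HasDerivAt (fun s => ψ s θ₀) ((θ₁ - (1 - σmin) * ψ t θ₀) / σ t) t) ∧
    (∀ t ∈ Icc (0 : ℝ) 1,
      Measure.map (ψ t) (gaussianReal 0 1)
        = gaussianReal (t * θ₁) ⟨(σ t) ^ 2, sq_nonneg _⟩) := by
  refine ⟨?_, fun t ht θ₀ => ?_, fun t _ => ?_⟩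
  · ext θ₀
    simp [hψ, hσ]
  · have hσt : 0 < σ t := by
      rw [hσ]
      nlinarith [hσmin.1, hσmin.2, ht.1, ht.2]
    have hderiv : HasDerivAt (fun s => s * θ₁ + (1 - (1 - σmin) * s) * θ₀)
        (1 * θ₁ + -((1 - σmin) * 1) * θ₀) t :=
      ((hasDerivAt_id t).mul_const θ₁).add
        ((((hasDerivAt_id t).const_mul (1 - σmin)).const_sub 1).mul_const θ₀)
    have hvelocity : (θ₁ - (1 - σmin) * ψ t θ₀) / σ t
        = 1 * θ₁ + -((1 - σmin) * 1) * θ₀ := by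
      rw [div_eq_iff hσt.ne', hψ, hσ]
      ring
    rw [hvelocity]
    simpa only [hψ, hσ] using hderiv
  · have hcomp : ψ t = (fun x => t * θ₁ + x) ∘ (fun x => σ t * x) := funext (hψ t)
    rw [hcomp, ← Measure.map_map (by fun_prop) (by fun_prop), gaussianReal_map_const_mul,
      gaussianReal_map_const_add, mul_zero, zero_add, mul_one]
    rfl
end

section
/- Let v : [0,1] × ℝ → ℝ and let ψ : [0,1] × ℝ → ℝ satisfy ψ_0 = id and ∂_t ψ_t(θ) = v_t(ψ_t(θ)). Assume that for each θ₀ ∈ ℝ, θ ↦ ψ_t(θ) is differentiable with ∂_θψ_0(θ₀) = 1, that s ↦ ∂_θ v_s(ψ_s(θ₀)) is continuous, and that t ↦ ∂_θψ_t(θ₀) is differentiable with ∂_t ∂_θψ_t(θ₀) = ∂_θv_t(ψ_t(θ₀)) · ∂_θψ_t(θ₀). Then: (i) ∂_θψ_t(θ₀) = exp(∫_0^t ∂_θv_s(ψ_s(θ₀)) ds) > 0 for all t ∈ [0,1]; (ii) if in addition ψ_1 is a bijection of ℝ with θ ↦ ∂_θψ_1(θ) continuous, and q₀ is a probability density on ℝ,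 then the pushforward under ψ_1 of the measure with density q₀ has a density q₁ satisfying q₁(ψ_1(θ)) = q₀(θ) · exp(−∫_0^1 ∂_θv_t(ψ_t(θ)) dt) for all θ ∈ ℝ. -/
open MeasureTheory Real Set

/-- A solution of the scalar linear equation `u' = a u` on `[b, c]` is its initial value times the
exponential of the integrated coefficient. -/
theorem eq_mul_exp_integral_of_hasDerivWithinAt {a u : ℝ → ℝ} {b c : ℝ}
    (ha : ContinuousOn a (Icc b c))
    (hu : ∀ t ∈ Icc b c, HasDerivWithinAt u (a t * u t) (Icc b c) t) {t : ℝ} (ht : t ∈ Icc b c) :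
    u t = u b * Real.exp (∫ s in b..t, a s) := by
  have hbc : b ≤ c := ht.1.trans ht.2
  set α : ℝ → ℝ := IccExtend hbc ((Icc b c).domRestrict a)
  have hα : Continuous α := (continuousOn_iff_continuous_domRestrict.1 ha).Icc_extend'
  have hαa : ∀ s ∈ Icc b c, α s = a s := fun s hs => IccExtend_of_mem hbc _ hs
  have hint : ∫ s in b..t, a s = ∫ s in b..t, α s := by
    refine intervalIntegral.integral_congr fun s hs => (hαa s ?_).symm
    rw [uIcc_of_le ht.1] at hs
    exact ⟨hs.1, hs.2.trans ht.2⟩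
  have hderiv : ∀ x ∈ Icc b c,
      HasDerivWithinAt (fun y => u y * Real.exp (-∫ s in b..y, α s)) 0 (Icc b c) x := by
    intro x hx
    have hA : HasDerivAt (fun y => ∫ s in b..y, α s) (α x) x :=
      hα.integral_hasStrictDerivAt b x |>.hasDerivAt
    refine ((hu x hx).mul hA.neg.exp.hasDerivWithinAt).congr_deriv ?_
    rw [hαa x hx]
    ring
  have hconst := constant_of_derivWithin_zero
    (fun x hx => (hderiv x hx).differentiableWithinAt)
    (fun x hx => (hderiv x (Ico_subset_Icc_self hx)).derivWithin
      (uniqueDiffOn_Icc (hx.1.trans_lt hx.2) x (Ico_subset_Icc_self hx))) t ht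
  simp only [intervalIntegral.integral_same, neg_zero, Real.exp_zero, mul_one] at hconst
  rw [hint, ← hconst, mul_assoc, ← Real.exp_add, neg_add_cancel, Real.exp_zero, mul_one]

/-- Change of variables for densities under a differentiable bijection of the line. -/
theorem map_withDensity_eq_of_bijective {f f' : ℝ → ℝ} (hf : Function.Bijective f)
    (hf' : ∀ x, HasDerivAt f (f' x) x) {p q : ℝ → ENNReal}
    (hpq : ∀ x, p x = ENNReal.ofReal |f' x| * q (f x)) :
    Measure.map f (volume.withDensity p) = volume.withDensity q := by
  have hmeas : Measurable f :=
    (continuous_iff_continuousAt.2 fun x => (hf' x).continuousAt).measurable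
  ext s hs
  rw [Measure.map_apply hmeas hs, withDensity_apply _ (hmeas hs), withDensity_apply _ hs]
  conv_rhs => rw [← image_preimage_eq s hf.surjective]
  rw [lintegral_image_eq_lintegral_abs_deriv_mul (hmeas hs)
    (fun x _ => (hf' x).hasDerivWithinAt) hf.injective.injOn]
  simp only [hpq]

/-- One-dimensional continuous normalizing flow: the spatial derivative of the flow is the
exponential of the time-integrated divergence, and the pushforward density satisfies
`q₁(ψ₁(θ)) = q₀(θ)·exp(−∫₀¹ ∂_θ v_t(ψ_t(θ)) dt)`. -/
theorem cnf_density_formula_1d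
    (v : ℝ → ℝ → ℝ) (ψ : ℝ → ℝ → ℝ) (hψ0 : ψ 0 = id)
    (hψ_flow : ∀ θ : ℝ, ∀ t ∈ Icc (0 : ℝ) 1, HasDerivAt (fun s => ψ s θ) (v t (ψ t θ)) t)
    (hψ_sdiff : ∀ t ∈ Icc (0 : ℝ) 1, ∀ θ₀ : ℝ, DifferentiableAt ℝ (ψ t) θ₀)
    (hψ_sderiv0 : ∀ θ₀ : ℝ, deriv (ψ 0) θ₀ = 1)
    (hv_cont : ∀ θ₀ : ℝ, ContinuousOn (fun s => deriv (v s) (ψ s θ₀)) (Icc (0 : ℝ) 1))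
    (hcommute : ∀ θ₀ : ℝ, ∀ t ∈ Icc (0 : ℝ) 1,
      HasDerivAt (fun s => deriv (ψ s) θ₀) (deriv (v t) (ψ t θ₀) * deriv (ψ t) θ₀) t)
    (hbij : Function.Bijective (ψ 1)) (hderiv_cont : Continuous (fun θ => deriv (ψ 1) θ))
    (q₀ : ℝ → ℝ) (hq₀_meas : Measurable q₀) (hq₀_nonneg : ∀ θ, 0 ≤ q₀ θ)
    (hq₀_prob : ∫ θ, q₀ θ = 1) :
    (∀ t ∈ Icc (0 : ℝ) 1, ∀ θ₀ : ℝ,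
      deriv (ψ t) θ₀ = Real.exp (∫ s in (0 : ℝ)..t, deriv (v s) (ψ s θ₀)) ∧
      0 < deriv (ψ t) θ₀) ∧
    ∃ q₁ : ℝ → ℝ,
      Measure.map (ψ 1) (volume.withDensity (fun θ => ENNReal.ofReal (q₀ θ)))
        = volume.withDensity (fun θ => ENNReal.ofReal (q₁ θ)) ∧
      ∀ θ : ℝ, q₁ (ψ 1 θ) = q₀ θ * Real.exp (-∫ t in (0 : ℝ)..1, deriv (v t) (ψ t θ)) := by
  have hflow : ∀ t ∈ Icc (0 : ℝ) 1, ∀ θ₀ : ℝ,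
      deriv (ψ t) θ₀ = Real.exp (∫ s in (0 : ℝ)..t, deriv (v s) (ψ s θ₀)) := by
    intro t ht θ₀
    have h := eq_mul_exp_integral_of_hasDerivWithinAt (u := fun s => deriv (ψ s) θ₀)
      (hv_cont θ₀) (fun s hs => (hcommute θ₀ s hs).hasDerivWithinAt) ht
    simpa only [hψ_sderiv0, one_mul] using h
  refine ⟨fun t ht θ₀ => ⟨hflow t ht θ₀, hflow t ht θ₀ ▸ Real.exp_pos _⟩, ?_⟩
  have h1 : (1 : ℝ) ∈ Icc (0 : ℝ) 1 := right_mem_Icc.2 zero_le_one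
  let e := Equiv.ofBijective (ψ 1) hbij
  have he : ∀ θ, e.symm (ψ 1 θ) = θ := e.symm_apply_apply
  refine ⟨fun y => q₀ (e.symm y) *
    Real.exp (-∫ t in (0 : ℝ)..1, deriv (v t) (ψ t (e.symm y))), ?_, fun θ => by simp only [he]⟩
  refine map_withDensity_eq_of_bijective hbij (fun θ => (hψ_sdiff 1 h1 θ).hasDerivAt) fun θ => ?_
  simp only [he]
  rw [hflow 1 h1 θ, abs_of_pos (Real.exp_pos _), ← ENNReal.ofReal_mul (Real.exp_pos _).le,
    mul_left_comm, ← Real.exp_add, add_neg_cancel, Real.exp_zero, mul_one]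
end
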